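/- For every n ≥ 1, LA_n = Σ_{k=1}^{n} C(3n−1, 3k−2) · LE_{k−1} · LS_{n−k}, where C(m,r) denotes the binomial coefficient. -/

import Mathlib

/-- `LAcount n`: linear extensions of the poset `A_n` — permutations `σ` of `{1,…,3n}`
(modeled 0-based on `Fin (3n)`) with `σ(3i+1) < σ(3i+2)`, `σ(3i+1) < σ(3i+3)` for
`0 ≤ i ≤ n-1` and `σ(3i) < σ(3i+2)` for `1 ≤ i ≤ n-1` (1-based positions). -/
def LAset (n : ℕ) : Finset (Equiv.Perm (Fin (3*n))) :=
  Finset.univ.filter fun σ =>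
    (∀ i < n, ∃ h : 3*i+2 < 3*n,
        σ ⟨3*i, by omega⟩ < σ ⟨3*i+1, by omega⟩ ∧ σ ⟨3*i, by omega⟩ < σ ⟨3*i+2, h⟩) ∧
    (∀ i < n, 1 ≤ i → ∃ h : 3*i+1 < 3*n, σ ⟨3*i-1, by omega⟩ < σ ⟨3*i+1, h⟩)

def LAcount (n : ℕ) : ℕ := (LAset n).card

/-- `LEcount n`: linear extensions of `E_n` — permutations of `{1,…,3n+1}` with the `A_n`
constraints together with `σ(3n) < σ(3n+1)` (1-based positions). -/
def LEset (n : ℕ) : Finset (Equiv.Perm (Fin (3*n+1))) :=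
  Finset.univ.filter fun σ =>
    (∀ i < n, ∃ h : 3*i+2 < 3*n+1,
        σ ⟨3*i, by omega⟩ < σ ⟨3*i+1, by omega⟩ ∧ σ ⟨3*i, by omega⟩ < σ ⟨3*i+2, h⟩) ∧
    (∀ i < n, 1 ≤ i → ∃ h : 3*i+1 < 3*n+1, σ ⟨3*i-1, by omega⟩ < σ ⟨3*i+1, h⟩) ∧
    (∀ _h : 1 ≤ n, σ ⟨3*n-1, by omega⟩ < σ ⟨3*n, by omega⟩)

def LEcount (n : ℕ) : ℕ := (LEset n).card

/-- `LScount n`: linear extensions of `S_n` — permutations of `{1,…,3n+1}` with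
`σ(3i+2) < σ(3i+3)`, `σ(3i+2) < σ(3i+4)` for `0 ≤ i ≤ n-1`, `σ(3i+1) < σ(3i+3)` for
`1 ≤ i ≤ n-1`, and `σ(1) < σ(3)` (1-based positions). -/
def LSset (n : ℕ) : Finset (Equiv.Perm (Fin (3*n+1))) :=
  Finset.univ.filter fun σ =>
    (∀ i < n, ∃ h : 3*i+3 < 3*n+1,
        σ ⟨3*i+1, by omega⟩ < σ ⟨3*i+2, by omega⟩ ∧ σ ⟨3*i+1, by omega⟩ < σ ⟨3*i+3, h⟩) ∧
    (∀ i < n, 1 ≤ i → ∃ h : 3*i+2 < 3*n+1, σ ⟨3*i, by omega⟩ < σ ⟨3*i+2, h⟩) ∧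
    (∀ _h : 1 ≤ n, σ ⟨0, by omega⟩ < σ ⟨2, by omega⟩)

def LScount (n : ℕ) : ℕ := (LSset n).card

/-- `LBcount n`: linear extensions of `B_n` — permutations of `{1,…,3n+2}` with the `S_n`
constraints together with `σ(3n+1) < σ(3n+2)` (1-based positions). -/
def LBset (n : ℕ) : Finset (Equiv.Perm (Fin (3*n+2))) :=
  Finset.univ.filter fun σ =>
    (∀ i < n, ∃ h : 3*i+3 < 3*n+2,
        σ ⟨3*i+1, by omega⟩ < σ ⟨3*i+2, by omega⟩ ∧ σ ⟨3*i+1, by omega⟩ < σ ⟨3*i+3, h⟩) ∧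
    (∀ i < n, 1 ≤ i → ∃ h : 3*i+2 < 3*n+2, σ ⟨3*i, by omega⟩ < σ ⟨3*i+2, h⟩) ∧
    (∀ _h : 1 ≤ n, σ ⟨0, by omega⟩ < σ ⟨2, by omega⟩) ∧
    σ ⟨3*n, by omega⟩ < σ ⟨3*n+1, by omega⟩

def LBcount (n : ℕ) : ℕ := (LBset n).card

/-- The number of linear extensions of the relation `r` restricted to `S`, as bijections onto
`Fin n`; it is `0` unless `n` is the cardinality of `S`. -/
noncomputable def linExtCount {α : Type*} (r : α → α → Prop) (S : Finset α) (n : ℕ) : ℕ :=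
  Nat.card {σ : S ≃ Fin n // ∀ a b : S, r a b → σ a < σ b}

section LinearExtensions

variable {α : Type*} {r : α → α → Prop}

theorem linExtCount_empty : linExtCount r ∅ 0 = 1 := by
  rw [linExtCount, Nat.card_eq_one_iff_unique]
  exact ⟨⟨fun a b => Subtype.ext (Equiv.ext fun x => absurd x.2 (Finset.notMem_empty _))⟩,
    ⟨⟨Equiv.equivOfIsEmpty _ _, fun a => absurd a.2 (Finset.notMem_empty _)⟩⟩⟩

/-- Counting linear extensions through an enumeration `f` of the underlying set. -/
theorem card_filter_perm_eq_linExtCount {m : ℕ} {P : Equiv.Perm (Fin m) → Prop}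
    [DecidablePred P] {S : Finset α} (f : Fin m → α) (hf : Function.Injective f)
    (hS : ∀ x, x ∈ S ↔ ∃ i, f i = x)
    (hP : ∀ σ, P σ ↔ ∀ i j, r (f i) (f j) → σ i < σ j) :
    (Finset.univ.filter P).card = linExtCount r S m := by
  let e : Fin m ≃ S := Equiv.ofBijective (fun i => ⟨f i, (hS _).2 ⟨i, rfl⟩⟩)
    ⟨fun i j h => hf (congrArg Subtype.val h), fun x =>
      let ⟨i, hi⟩ := (hS x).1 x.2
      ⟨i, Subtype.ext hi⟩⟩
  rw [← Fintype.card_subtype, ← Nat.card_eq_fintype_card]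
  refine Nat.card_congr ((Equiv.equivCongr e (Equiv.refl _)).subtypeEquiv fun σ => ?_)
  rw [hP, ← e.forall_congr_right]
  refine forall_congr' fun i => ?_
  rw [← e.forall_congr_right]
  refine forall_congr' fun j => ?_
  change _ ↔ (r (f i) (f j) → _)
  simp

variable [DecidableEq α]

/-- Bijections onto `Fin (n + 1)` sending `a` to `0` correspond to bijections from the
complement of `a` onto `Fin n`. -/
def equivEraseOfApplyEqZero {S : Finset α} {n : ℕ} (a : S) :
    {σ : S ≃ Fin (n + 1) // σ a = 0} ≃ ((S.erase a : Finset α) ≃ Fin n) where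
  toFun σ :=
    { toFun := fun x => (σ.1 ⟨x, Finset.mem_of_mem_erase x.2⟩).pred fun h => by
        have := σ.1.injective (h.trans σ.2.symm)
        exact Finset.ne_of_mem_erase x.2 (congrArg Subtype.val this)
      invFun := fun y => ⟨σ.1.symm y.succ, Finset.mem_erase.2 ⟨fun h => by
        have h1 : σ.1.symm y.succ = a := Subtype.ext h
        rw [Equiv.symm_apply_eq, σ.2] at h1
        exact Fin.succ_ne_zero _ h1, Subtype.prop _⟩⟩
      left_inv := fun x => by simp
      right_inv := fun y => by simp }
  invFun τ :=
    ⟨{ toFun := fun x => if h : x = a then 0 else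
        (τ ⟨x, Finset.mem_erase.2 ⟨fun h' => h (Subtype.ext h'), x.2⟩⟩).succ
       invFun := Fin.cases a fun y => ⟨τ.symm y, Finset.mem_of_mem_erase (τ.symm y).2⟩
       left_inv := fun x => by
        by_cases h : x = a <;> simp [h]
       right_inv := fun y => by
        refine Fin.cases ?_ (fun y => ?_) y
        · simp
        · have : (τ.symm y : α) ≠ a := Finset.ne_of_mem_erase (τ.symm y).2
          simp [Subtype.ext_iff, this] }, by simp⟩
  left_inv σ := by
    ext x
    by_cases h : x = a
    · rw [Equiv.coe_fn_mk, dif_pos h, h, σ.2]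
    · simp only [Equiv.coe_fn_mk, dif_neg h, Fin.succ_pred]
  right_inv τ := by
    refine Equiv.ext fun x => Fin.succ_injective _ ?_
    rw [Equiv.coe_fn_mk, Fin.succ_pred]
    exact dif_neg fun h => Finset.ne_of_mem_erase x.2 (congrArg Subtype.val h)

theorem succ_equivEraseOfApplyEqZero {S : Finset α} {n : ℕ} {a : S}
    (σ : {σ : S ≃ Fin (n + 1) // σ a = 0}) (x : (S.erase a : Finset α)) :
    (equivEraseOfApplyEqZero a σ x).succ = σ.1 ⟨x, Finset.mem_of_mem_erase x.2⟩ := by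
  rw [equivEraseOfApplyEqZero, Equiv.coe_fn_mk, Equiv.coe_fn_mk, Fin.succ_pred]

theorem card_linExt_apply_eq_zero {S : Finset α} {n : ℕ} {a : S}
    (ha : ∀ x ∈ S, ¬ r x a) :
    Nat.card {σ : {σ : S ≃ Fin (n + 1) // ∀ a b : S, r a b → σ a < σ b} // σ.1 a = 0} =
      linExtCount r (S.erase a) n := by
  refine Nat.card_congr ((Equiv.subtypeSubtypeEquivSubtypeInter _ _).trans <|
    (Equiv.subtypeEquivRight fun σ => and_comm).trans <|
    (Equiv.subtypeSubtypeEquivSubtypeInter _ _).symm.trans <|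
    (equivEraseOfApplyEqZero a).subtypeEquiv fun σ => ?_)
  constructor
  · intro h x y hxy
    rw [← Fin.succ_lt_succ_iff, succ_equivEraseOfApplyEqZero, succ_equivEraseOfApplyEqZero]
    exact h ⟨x, Finset.mem_of_mem_erase x.2⟩ ⟨y, Finset.mem_of_mem_erase y.2⟩ hxy
  · intro h x y hxy
    have hy : y ≠ a := fun h' => ha x x.2 (h' ▸ hxy)
    by_cases hx : x = a
    · rw [hx, σ.2, Fin.pos_iff_ne_zero]
      exact fun h' => hy (σ.1.injective (h'.trans σ.2.symm))
    · have := h ⟨x, Finset.mem_erase.2 ⟨fun h' => hx (Subtype.ext h'), x.2⟩⟩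
        ⟨y, Finset.mem_erase.2 ⟨fun h' => hy (Subtype.ext h'), y.2⟩⟩ hxy
      rwa [← Fin.succ_lt_succ_iff, succ_equivEraseOfApplyEqZero,
        succ_equivEraseOfApplyEqZero] at this

open Classical in
/-- Linear extensions are counted by removing the element placed first, which is minimal. -/
theorem linExtCount_succ (S : Finset α) (n : ℕ) :
    linExtCount r S (n + 1) =
      ∑ a ∈ S with ∀ x ∈ S, ¬ r x a, linExtCount r (S.erase a) n := by
  rw [linExtCount, ← Nat.card_congr (Equiv.sigmaFiberEquiv
    fun σ : {σ : S ≃ Fin (n + 1) // ∀ a b : S, r a b → σ a < σ b} => σ.1.symm 0),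
    Nat.card_sigma, Finset.sum_filter, ← Finset.sum_coe_sort S]
  refine Finset.sum_congr rfl fun a _ => ?_
  simp_rw [Equiv.symm_apply_eq, eq_comm (a := (0 : Fin (n + 1)))]
  split_ifs with ha
  · exact card_linExt_apply_eq_zero ha
  · push Not at ha
    obtain ⟨x, hx, hxa⟩ := ha
    rw [Nat.card_eq_zero]
    refine Or.inl ⟨fun σ => ?_⟩
    have := σ.1.2 ⟨x, hx⟩ a hxa
    rw [σ.2] at this
    exact absurd this (Fin.not_lt_zero _)

/-- The linear extensions of a disjoint union of two unrelated sets are shuffles. -/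
theorem linExtCount_union {S T : Finset α} {s t : ℕ} (hs : S.card = s) (ht : T.card = t)
    (hd : Disjoint S T) (hST : ∀ x ∈ S, ∀ y ∈ T, ¬ r x y ∧ ¬ r y x) :
    linExtCount r (S ∪ T) (s + t) =
      (s + t).choose s * linExtCount r S s * linExtCount r T t := by
  classical
  have key (m : ℕ) : ∀ (S T : Finset α) (s t : ℕ), s + t = m → S.card = s → T.card = t →
      Disjoint S T → (∀ x ∈ S, ∀ y ∈ T, ¬ r x y ∧ ¬ r y x) →
      linExtCount r (S ∪ T) m = m.choose s * linExtCount r S s * linExtCount r T t := by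
    induction m with
    | zero =>
      intro S T s t hm hs ht _ _
      obtain ⟨rfl, rfl⟩ : s = 0 ∧ t = 0 := by omega
      rw [Finset.card_eq_zero] at hs ht
      simp [hs, ht, linExtCount_empty]
    | succ m ih =>
      intro S T s t hm hs ht hd hST
      rcases s with _ | s
      · rw [Finset.card_eq_zero] at hs
        obtain rfl : t = m + 1 := by omega
        simp [hs, linExtCount_empty]
      rcases t with _ | t
      · rw [Finset.card_eq_zero] at ht
        obtain rfl : s = m := by omega
        simp [ht, linExtCount_empty]
      have hS : ∑ a ∈ S with ∀ x ∈ S ∪ T, ¬ r x a, linExtCount r ((S ∪ T).erase a) m =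
          m.choose s * linExtCount r S (s + 1) * linExtCount r T (t + 1) := by
        rw [linExtCount_succ S, Finset.mul_sum, Finset.sum_mul]
        refine Finset.sum_congr (Finset.filter_congr fun a ha => ?_) fun a ha => ?_
        · simp only [Finset.mem_union]
          exact ⟨fun h x hx => h x (Or.inl hx),
            fun h x hx => hx.elim (h x) fun hx => (hST a ha x hx).2⟩
        · have ha := Finset.mem_of_mem_filter a ha
          rw [Finset.erase_union_distrib,
            Finset.erase_eq_of_notMem (Finset.disjoint_left.1 hd ha)]
          exact ih _ _ _ _ (by omega) (by rw [Finset.card_erase_of_mem ha, hs]; rfl) ht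
            (Finset.disjoint_of_subset_left (Finset.erase_subset _ _) hd)
            fun x hx => hST x (Finset.mem_of_mem_erase hx)
      have hT : ∑ a ∈ T with ∀ x ∈ S ∪ T, ¬ r x a, linExtCount r ((S ∪ T).erase a) m =
          m.choose (s + 1) * linExtCount r S (s + 1) * linExtCount r T (t + 1) := by
        rw [linExtCount_succ T, Finset.mul_sum]
        refine Finset.sum_congr (Finset.filter_congr fun a ha => ?_) fun a ha => ?_
        · simp only [Finset.mem_union]
          exact ⟨fun h x hx => h x (Or.inr hx),
            fun h x hx => hx.elim (fun hx => (hST x hx a ha).1) (h x)⟩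
        · have ha := Finset.mem_of_mem_filter a ha
          rw [Finset.erase_union_distrib,
            Finset.erase_eq_of_notMem (Finset.disjoint_right.1 hd ha)]
          exact ih _ _ _ _ (by omega) hs (by rw [Finset.card_erase_of_mem ha, ht]; rfl)
            (Finset.disjoint_of_subset_right (Finset.erase_subset _ _) hd)
            fun x hx y hy => hST x hx y (Finset.mem_of_mem_erase hy)
      rw [linExtCount_succ, Finset.filter_union,
        Finset.sum_union (Finset.disjoint_filter_filter hd), hS, hT, Nat.choose_succ_succ]
      ring
  exact key _ S T s t rfl hs ht hd hST

end LinearExtensions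

/-- The cover relations of the infinite poset on `ℕ` that begins with every `A_n`
(0-based positions). -/
def ladderRel (x y : ℕ) : Prop :=
  (x % 3 = 0 ∧ (y = x + 1 ∨ y = x + 2)) ∨ (x % 3 = 2 ∧ y = x + 2)

theorem LAcount_eq_linExtCount (n : ℕ) :
    LAcount n = linExtCount ladderRel (Finset.range (3 * n)) (3 * n) := by
  refine card_filter_perm_eq_linExtCount (fun i => (i : ℕ)) Fin.val_injective
    (fun x => ?_) fun σ => ?_
  · exact ⟨fun h => ⟨⟨x, Finset.mem_range.1 h⟩, rfl⟩,
      fun ⟨i, hi⟩ => Finset.mem_range.2 (hi ▸ i.2)⟩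
  · constructor
    · rintro ⟨h1, h2⟩ ⟨i, hi⟩ ⟨j, hj⟩ (⟨h, rfl | rfl⟩ | ⟨h, rfl⟩) <;> dsimp only at h hj
      · obtain ⟨q, rfl⟩ : ∃ q, i = 3 * q := ⟨i / 3, by omega⟩
        exact (h1 q (by omega)).2.1
      · obtain ⟨q, rfl⟩ : ∃ q, i = 3 * q := ⟨i / 3, by omega⟩
        exact (h1 q (by omega)).2.2
      · obtain ⟨q, rfl⟩ : ∃ q, i = 3 * (q + 1) - 1 := ⟨i / 3, by omega⟩
        exact (h2 (q + 1) (by omega) (by omega)).2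
    · intro h
      refine ⟨fun i hi => ⟨by omega, h _ _ ?_, h _ _ ?_⟩, fun i hi hi1 => ⟨by omega, h _ _ ?_⟩⟩ <;>
      · dsimp only [ladderRel]
        omega

theorem LEcount_eq_linExtCount (n : ℕ) :
    LEcount n =
      linExtCount ladderRel (insert (3 * n + 1) (Finset.range (3 * n))) (3 * n + 1) := by
  refine card_filter_perm_eq_linExtCount (fun i => if (i : ℕ) < 3 * n then (i : ℕ) else i + 1)
    (fun i j hij => ?_) (fun x => ?_) fun σ => ?_
  · dsimp only at hij
    ext
    split_ifs at hij <;> omega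
  · rw [Finset.mem_insert, Finset.mem_range]
    constructor
    · rintro (rfl | h)
      · exact ⟨⟨3 * n, by omega⟩, by simp⟩
      · exact ⟨⟨x, by omega⟩, by simp [h]⟩
    · rintro ⟨i, rfl⟩
      split_ifs <;> omega
  · constructor
    · rintro ⟨h1, h2, h3⟩ ⟨i, hi⟩ ⟨j, hj⟩ h
      dsimp only [ladderRel] at h
      have hin : i < 3 * n := by split_ifs at h <;> omega
      rw [if_pos hin] at h
      by_cases hjn : j < 3 * n
      · rw [if_pos hjn] at h
        rcases h with ⟨h, rfl | rfl⟩ | ⟨h, rfl⟩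
        · obtain ⟨q, rfl⟩ : ∃ q, i = 3 * q := ⟨i / 3, by omega⟩
          exact (h1 q (by omega)).2.1
        · obtain ⟨q, rfl⟩ : ∃ q, i = 3 * q := ⟨i / 3, by omega⟩
          exact (h1 q (by omega)).2.2
        · obtain ⟨q, rfl⟩ : ∃ q, i = 3 * (q + 1) - 1 := ⟨i / 3, by omega⟩
          exact (h2 (q + 1) (by omega) (by omega)).2
      · rw [if_neg hjn] at h
        obtain rfl : i = 3 * n - 1 := by omega
        obtain rfl : j = 3 * n := by omega
        exact h3 (by omega)
    · intro h
      refine ⟨fun i hi => ⟨by omega, h _ _ ?_, h _ _ ?_⟩,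
        fun i hi hi1 => ⟨by omega, h _ _ ?_⟩, fun hn => h _ _ ?_⟩ <;>
      · dsimp only [ladderRel]
        split_ifs <;> omega

theorem LScount_eq_linExtCount (k n : ℕ) :
    LScount n =
      linExtCount ladderRel (Finset.Ico (3 * k + 2) (3 * k + 2 + (3 * n + 1))) (3 * n + 1) := by
  refine card_filter_perm_eq_linExtCount (fun i => 3 * k + 2 + (i : ℕ))
    (fun i j hij => Fin.ext (Nat.add_left_cancel hij)) (fun x => ?_) fun σ => ?_
  · rw [Finset.mem_Ico]
    constructor
    · intro h
      exact ⟨⟨x - (3 * k + 2), by omega⟩, by dsimp only; omega⟩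
    · rintro ⟨i, rfl⟩
      omega
  · constructor
    · rintro ⟨h1, h2, h3⟩ ⟨i, hi⟩ ⟨j, hj⟩ h
      dsimp only [ladderRel] at h
      have h : (i % 3 = 1 ∧ (j = i + 1 ∨ j = i + 2)) ∨ (i % 3 = 0 ∧ j = i + 2) := by omega
      rcases h with ⟨h, rfl | rfl⟩ | ⟨h, rfl⟩
      · obtain ⟨q, rfl⟩ : ∃ q, i = 3 * q + 1 := ⟨i / 3, by omega⟩
        exact (h1 q (by omega)).2.1
      · obtain ⟨q, rfl⟩ : ∃ q, i = 3 * q + 1 := ⟨i / 3, by omega⟩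
        exact (h1 q (by omega)).2.2
      · obtain ⟨q, rfl⟩ : ∃ q, i = 3 * q := ⟨i / 3, by omega⟩
        rcases Nat.eq_zero_or_pos q with rfl | hq
        · exact h3 (by omega)
        · exact (h2 q (by omega) hq).2
    · intro h
      refine ⟨fun i hi => ⟨by omega, h _ _ ?_, h _ _ ?_⟩,
        fun i hi hi1 => ⟨by omega, h _ _ ?_⟩, fun hn => h _ _ ?_⟩ <;>
      · dsimp only [ladderRel]
        omega

/-- Removing the minimal element `3 * k` disconnects `A_{k + m + 1}`. -/
theorem linExtCount_ladderRel_erase (k m : ℕ) :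
    linExtCount ladderRel ((Finset.range (3 * (k + m + 1))).erase (3 * k))
        ((3 * k + 1) + (3 * m + 1)) =
      ((3 * k + 1) + (3 * m + 1)).choose (3 * k + 1) * LEcount k * LScount m := by
  rw [LEcount_eq_linExtCount, LScount_eq_linExtCount k, ← linExtCount_union]
  · congr 1
    ext x
    simp only [Finset.mem_erase, Finset.mem_range, Finset.mem_union, Finset.mem_insert,
      Finset.mem_Ico]
    omega
  · rw [Finset.card_insert_of_notMem (by simp), Finset.card_range]
  · simp
  · rw [Finset.disjoint_left]
    intro x
    simp only [Finset.mem_range, Finset.mem_insert, Finset.mem_Ico]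
    omega
  · intro x hx y hy
    simp only [Finset.mem_range, Finset.mem_insert, Finset.mem_Ico] at hx hy
    simp only [ladderRel]
    omega

theorem LA_rec (n : ℕ) (hn : 1 ≤ n) :
    LAcount n = ∑ k ∈ Finset.Icc 1 n,
      Nat.choose (3*n-1) (3*k-2) * LEcount (k-1) * LScount (n-k) := by
  classical
  obtain ⟨m, hm⟩ : ∃ m, 3 * n = m + 1 := ⟨3 * n - 1, by omega⟩
  rw [LAcount_eq_linExtCount]
  conv_lhs => rw [show linExtCount ladderRel (Finset.range (3 * n)) (3 * n) =
    linExtCount ladderRel (Finset.range (3 * n)) (m + 1) by rw [← hm]]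
  rw [linExtCount_succ]
  symm
  refine Finset.sum_bij (fun k _ => 3 * (k - 1)) ?_ ?_ ?_ ?_
  · intro k hk
    rw [Finset.mem_Icc] at hk
    simp only [Finset.mem_filter, Finset.mem_range, ladderRel]
    exact ⟨by omega, fun x _ => by omega⟩
  · intro k hk l hl h
    rw [Finset.mem_Icc] at hk hl
    omega
  · intro a ha
    simp only [Finset.mem_filter, Finset.mem_range, ladderRel] at ha
    have h1 := ha.2 (a - 1) (by omega)
    have h2 := ha.2 (a - 2) (by omega)
    exact ⟨a / 3 + 1, Finset.mem_Icc.2 ⟨by omega, by omega⟩, by omega⟩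
  · intro k hk
    rw [Finset.mem_Icc] at hk
    obtain ⟨k, rfl⟩ : ∃ q, k = q + 1 := ⟨k - 1, by omega⟩
    obtain ⟨l, rfl⟩ : ∃ l, n = k + l + 1 := ⟨n - (k + 1), by omega⟩
    obtain rfl : m = (3 * k + 1) + (3 * l + 1) := by omega
    rw [show k + 1 - 1 = k by omega, linExtCount_ladderRel_erase,
      show k + l + 1 - (k + 1) = l by omega, show 3 * (k + 1) - 2 = 3 * k + 1 by omega, hm,
      Nat.add_sub_cancel]
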